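/- Let (X, ρ) be a weighted space. For every continuous linear functional ℓ : 𝓑^ρ(X) → ℝ there exists a finite signed Radon measure μ on X such that ℓ(f) = ∫_X f(x) μ(dx) for all f ∈ 𝓑^ρ(X); moreover ∫_X ρ(x) |μ|(dx) = ‖ℓ‖, where |μ| denotes the total variation measure of μ and ‖ℓ‖ the operator norm of ℓ on 𝓑^ρ(X). -/

import Mathlib

open MeasureTheory Filter Set Topology

namespace GenFeller

variable {X : Type*} [TopologicalSpace X]

/-- `ρ` is an admissible weight function on `X`: positive with compact sublevel sets. -/
def Admissible (ρ : X → ℝ) : Prop :=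
  (∀ x, 0 < ρ x) ∧ ∀ R : ℝ, 0 < R → IsCompact {x : X | ρ x ≤ R}

/-- The weighted sup-norm `‖f‖_ρ = sup_x ρ(x)⁻¹ |f x|`. -/
noncomputable def rnorm (ρ : X → ℝ) (f : X → ℝ) : ℝ :=
  sSup (Set.range fun x => (ρ x)⁻¹ * |f x|)

/-- `f ∈ B^ρ(X)`. -/
def MemB (ρ : X → ℝ) (f : X → ℝ) : Prop :=
  ∃ C : ℝ, ∀ x, |f x| ≤ C * ρ x

/-- `f ∈ 𝓑^ρ(X)`: `f ∈ B^ρ(X)` and `f` lies in the `‖·‖_ρ`-closure of the bounded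
continuous functions. -/
def MemCb (ρ : X → ℝ) (f : X → ℝ) : Prop :=
  MemB ρ f ∧ ∀ ε : ℝ, 0 < ε → ∃ g : X → ℝ, Continuous g ∧ (∃ C : ℝ, ∀ x, |g x| ≤ C) ∧
    ∀ x, |f x - g x| ≤ ε * ρ x

/-- `T` is linear on `𝓑^ρ(X)`. -/
def LinOn (ρ : X → ℝ) (T : (X → ℝ) → (X → ℝ)) : Prop :=
  (∀ f g, MemCb ρ f → MemCb ρ g → T (f + g) = T f + T g) ∧
  (∀ (c : ℝ) (f), MemCb ρ f → T (c • f) = c • T f)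

/-- `‖T f‖_ρ ≤ C ‖f‖_ρ` for all `f ∈ 𝓑^ρ(X)`, stated pointwise. -/
def OpBound (ρ : X → ℝ) (T : (X → ℝ) → (X → ℝ)) (C : ℝ) : Prop :=
  ∀ f, MemCb ρ f → ∀ x, |T f x| ≤ C * rnorm ρ f * ρ x

/-- A generalized Feller semigroup on `𝓑^ρ(X)` (properties F1–F5). -/
structure IsGenFeller (ρ : X → ℝ) (P : ℝ → (X → ℝ) → (X → ℝ)) : Prop where
  maps : ∀ t, 0 ≤ t → ∀ f, MemCb ρ f → MemCb ρ (P t f)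
  lin : ∀ t, 0 ≤ t → LinOn ρ (P t)
  id0 : ∀ f, MemCb ρ f → P 0 f = f
  law : ∀ s t, 0 ≤ s → 0 ≤ t → ∀ f, MemCb ρ f → P (t + s) f = P t (P s f)
  ptconv : ∀ f, MemCb ρ f → ∀ x,
    Tendsto (fun t => P t f x) (nhdsWithin 0 (Set.Ioi 0)) (nhds (f x))
  locbdd : ∃ C : ℝ, ∃ ε : ℝ, 0 < ε ∧ ∀ t ∈ Set.Icc (0:ℝ) ε, OpBound ρ (P t) C
  pos : ∀ t, 0 ≤ t → ∀ f, MemCb ρ f → (∀ x, 0 ≤ f x) → ∀ x, 0 ≤ P t f x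

/-- `‖P_t‖ ≤ M exp(ω t)` for all `t ≥ 0`. -/
def GrowthBound (ρ : X → ℝ) (P : ℝ → (X → ℝ) → (X → ℝ)) (M ω : ℝ) : Prop :=
  ∀ t, 0 ≤ t → OpBound ρ (P t) (M * Real.exp (ω * t))

/-- `g` is the value of the generator of `P` at `f` (limit in `‖·‖_ρ`). -/
def IsGenerator (ρ : X → ℝ) (P : ℝ → (X → ℝ) → (X → ℝ)) (f g : X → ℝ) : Prop :=
  MemCb ρ f ∧ MemCb ρ g ∧
  Tendsto (fun t : ℝ => rnorm ρ (fun x => t⁻¹ * (P t f x - f x) - g x))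
    (nhdsWithin 0 (Set.Ioi 0)) (nhds 0)

/-- `D` is a set of elements of `𝓑^ρ(X)` which is `‖·‖_ρ`-dense in it. -/
def DenseIn (ρ : X → ℝ) (D : Set (X → ℝ)) : Prop :=
  (∀ f ∈ D, MemCb ρ f) ∧
  ∀ f, MemCb ρ f → ∀ ε : ℝ, 0 < ε → ∃ h ∈ D, rnorm ρ (fun x => f x - h x) ≤ ε

/-- Operator norm of a linear functional on `𝓑^ρ(X)`. -/
noncomputable def opNormF (ρ : X → ℝ) (ℓ : (X → ℝ) → ℝ) : ℝ :=
  sSup {r : ℝ | ∃ f, MemCb ρ f ∧ rnorm ρ f ≤ 1 ∧ r = |ℓ f|}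

/-- Operator norm of an operator on `𝓑^ρ(X)`. -/
noncomputable def opNormOp (ρ : X → ℝ) (B : (X → ℝ) → (X → ℝ)) : ℝ :=
  sSup {r : ℝ | ∃ f, MemCb ρ f ∧ rnorm ρ f ≤ 1 ∧ r = rnorm ρ (B f)}

end GenFeller

open GenFeller MeasureTheory

open scoped NNReal ENNReal CompactlySupported


theorem aux_lsc {Y : Type*} [TopologicalSpace Y] [CompactSpace Y] [T2Space Y]
    [MeasurableSpace Y] [BorelSpace Y] (m : Measure Y) [IsFiniteMeasure m] [m.WeaklyRegular]
    (r : Y → ℝ≥0∞) (hr : ∀ a : ℝ≥0, IsClosed {y | r y ≤ a}) (C : ℝ≥0∞)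
    (h : ∀ F : C(Y, ℝ≥0), (∀ y, (F y : ℝ≥0∞) ≤ r y) → ∫⁻ y, F y ∂m ≤ C) :
    ∫⁻ y, r y ∂m ≤ C := by
  rw [lintegral_eq_nnreal]
  refine iSup₂_le fun φ hφ => ?_
  rw [← SimpleFunc.lintegral_eq_lintegral]
  simp only [SimpleFunc.map_apply]
  have hfin : ∫⁻ y, φ y ∂m ≠ ∞ := by
    obtain ⟨K, hK⟩ := φ.exists_forall_le
    refine ne_top_of_le_ne_top (ENNReal.mul_ne_top (ENNReal.coe_ne_top (r := K)) (measure_ne_top m univ)) ?_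
    calc ∫⁻ y, φ y ∂m ≤ ∫⁻ y, (K : ℝ≥0∞) ∂m := lintegral_mono fun y => ENNReal.coe_le_coe.2 (hK y)
      _ = _ := by simp
  have key : ∀ ε : ℝ≥0, 0 < ε → ∫⁻ y, φ y ∂m ≤ C + (m univ + 1) * ε := by
    intro ε hε
    obtain ⟨g, hg, hgu, hgi⟩ := SimpleFunc.exists_upperSemicontinuous_le_lintegral_le φ hfin
      (ε := ε) (by exact_mod_cast hε.ne')
    have : ∃ F : C(Y, ℝ≥0), (∀ y, (F y : ℝ≥0∞) ≤ r y) ∧ ∀ z ∈ (univ : Set Y), g z ≤ F z + ε := by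
      refine isCompact_univ.induction_on (p := fun s => ∃ F : C(Y, ℝ≥0), (∀ y, (F y : ℝ≥0∞) ≤ r y) ∧ ∀ z ∈ s, g z ≤ F z + ε) ?_ ?_ ?_ ?_
      · exact ⟨0, by simp, by simp⟩
      · rintro s t hst ⟨F, hF, hF'⟩
        exact ⟨F, hF, fun z hz => hF' z (hst hz)⟩
      · rintro s t ⟨F, hF, hF'⟩ ⟨G, hG, hG'⟩
        refine ⟨F ⊔ G, fun y => ?_, ?_⟩
        · rcases le_total (F y) (G y) with h | h
          · simpa [h] using hG y
          · simpa [h] using hF y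
        · rintro z (hz | hz)
          · exact (hF' z hz).trans (by gcongr; simp)
          · exact (hG' z hz).trans (by gcongr; simp)
      · intro y _
        obtain ⟨F, hF, hFy⟩ : ∃ F : C(Y, ℝ≥0), (∀ y, (F y : ℝ≥0∞) ≤ r y) ∧ g y < F y + ε := by
          rcases lt_or_ge (g y) ε with hlt | hge
          · exact ⟨0, by simp, by simpa⟩
          · set a : ℝ≥0 := g y - ε / 2 with ha
            have hε2 : 0 < ε / 2 := half_pos hε
            have hε3 : ε / 2 < ε := half_lt_self hε
            have hay : a < g y := tsub_lt_self (hε.trans_le hge) hε2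
            have hary : ¬ r y ≤ a := by
              rw [not_le]
              calc (a : ℝ≥0∞) < g y := by exact_mod_cast hay
                _ ≤ φ y := by exact_mod_cast hg y
                _ ≤ r y := hφ y
            obtain ⟨u, hu0, hu1, hu⟩ := exists_continuous_zero_one_of_isClosed (hr a)
              (isClosed_singleton (x := y)) (by simpa using hary)
            refine ⟨⟨fun z => a * (u z).toNNReal, by fun_prop⟩, fun z => ?_, ?_⟩
            · by_cases hz : r z ≤ a
              · have : u z = 0 := hu0 hz
                simp [this]
              · refine le_trans ?_ (not_le.1 hz).le
                have : (u z).toNNReal ≤ 1 := by simpa using (hu z).2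
                have h2 : a * (u z).toNNReal ≤ a := mul_le_of_le_one_right zero_le this
                exact_mod_cast h2
            · have : u y = 1 := hu1 rfl
              simp only [ContinuousMap.coe_mk, this, Real.toNNReal_one, mul_one]
              have : g y ≤ a + ε / 2 := le_tsub_add
              exact this.trans_lt (by gcongr)
        obtain ⟨c, hc1, hc2⟩ := exists_between hFy
        refine ⟨{z | g z < F z + ε}, mem_nhdsWithin_of_mem_nhds ?_, F, hF, fun z hz => le_of_lt hz⟩
        have h1 := hgu y c hc1
        have h2 : ∀ᶠ z in 𝓝 y, c < F z + ε :=
          ((F.continuous.add continuous_const).tendsto y).eventually (lt_mem_nhds hc2)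
        filter_upwards [h1, h2] with z h1 h2 using h1.trans h2
    obtain ⟨F, hF, hF'⟩ := this
    calc ∫⁻ y, φ y ∂m ≤ (∫⁻ y, g y ∂m) + ε := hgi
      _ ≤ (∫⁻ y, (F y + ε : ℝ≥0∞) ∂m) + ε := by
          gcongr with y; exact_mod_cast hF' y (mem_univ y)
      _ = (∫⁻ y, F y ∂m) + ε * m univ + ε := by
          rw [lintegral_add_right _ measurable_const]; simp
      _ ≤ C + ε * m univ + ε := by gcongr; exact h F hF
      _ = _ := by ring
  have hA : m univ + 1 ≠ ∞ := by simp
  have : Tendsto (fun ε : ℝ≥0 => C + (m univ + 1) * (ε : ℝ≥0∞)) (𝓝[>] 0) (𝓝 (C + (m univ + 1) * ((0:ℝ≥0) : ℝ≥0∞))) := by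
    refine tendsto_nhdsWithin_of_tendsto_nhds ?_
    refine Tendsto.const_add _ (ENNReal.Tendsto.const_mul ?_ (Or.inr hA))
    exact (ENNReal.continuous_coe.tendsto 0)
  have h3 := ge_of_tendsto this (b := ∫⁻ y, φ y ∂m) (by filter_upwards [self_mem_nhdsWithin] with ε hε using key ε hε)
  simpa using h3

theorem aux_riesz_pos {Y : Type*} [TopologicalSpace Y] [CompactSpace Y] [T2Space Y]
    [MeasurableSpace Y] [BorelSpace Y] (Λ : C(Y, ℝ≥0) → ℝ) (h0 : ∀ F, 0 ≤ Λ F)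
    (hadd : ∀ F G, Λ (F + G) = Λ F + Λ G) (hsmul : ∀ (c : ℝ≥0) F, Λ (c • F) = c * Λ F) :
    ∃ m : Measure Y, IsFiniteMeasure m ∧ m.Regular ∧
      ∀ F : C(Y, ℝ≥0), ∫⁻ y, F y ∂m = ENNReal.ofReal (Λ F) := by
  let Λ' : C_c(Y, ℝ≥0) →ₗ[ℝ≥0] ℝ≥0 :=
    { toFun := fun F => (Λ F.toContinuousMap).toNNReal
      map_add' := fun F G => by
        rw [← Real.toNNReal_add (h0 _) (h0 _), ← hadd]; rfl
      map_smul' := fun c F => by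
        have : Λ ((c • F).toContinuousMap) = c * Λ F.toContinuousMap := by rw [← hsmul]; rfl
        rw [this, Real.toNNReal_mul c.coe_nonneg]; simp }
  refine ⟨NNRealRMK.rieszMeasure Λ', ?_, inferInstance, fun F => ?_⟩
  · infer_instance
  · have := NNRealRMK.lintegral_rieszMeasure Λ' (CompactlySupportedContinuousMap.continuousMapEquiv F)
    exact this

/-- The sup functional. -/
noncomputable def lamF {Y : Type*} [TopologicalSpace Y] (L : C(Y, ℝ) → ℝ) (F : C(Y, ℝ≥0)) : ℝ :=
  sSup (L '' {G | ∀ y, |G y| ≤ F y})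

theorem aux_riesz {Y : Type*} [TopologicalSpace Y] [CompactSpace Y] [T2Space Y]
    [MeasurableSpace Y] [BorelSpace Y] (L : C(Y, ℝ) →ₗ[ℝ] ℝ)
    (M : ℝ) (hM : ∀ G, |L G| ≤ M * ‖G‖) :
    ∃ p n : Measure Y, IsFiniteMeasure p ∧ IsFiniteMeasure n ∧ p.Regular ∧ n.Regular ∧
      (∀ F : C(Y, ℝ), L F = ∫ y, F y ∂p - ∫ y, F y ∂n) ∧
      ∀ (F : C(Y, ℝ≥0)) (B : ℝ), (∀ G : C(Y, ℝ), (∀ y, |G y| ≤ F y) → L G ≤ B) →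
        ∫⁻ y, F y ∂(p + n) ≤ ENNReal.ofReal B := by
  have hne : ∀ F : C(Y, ℝ≥0), (L '' {G | ∀ y, |G y| ≤ F y}).Nonempty :=
    fun F => ⟨L 0, 0, by simp, rfl⟩
  have hbd : ∀ F : C(Y, ℝ≥0), BddAbove (L '' {G | ∀ y, |G y| ≤ F y}) := by
    intro F
    let F' : C(Y, ℝ) := ⟨fun y => F y, by fun_prop⟩
    refine ⟨|M| * ‖F'‖, ?_⟩
    rintro _ ⟨G, hG, rfl⟩
    have : ‖G‖ ≤ ‖F'‖ := (ContinuousMap.norm_le _ (norm_nonneg _)).2 fun y =>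
      (hG y).trans ((le_abs_self _).trans (F'.norm_coe_le_norm y))
    calc L G ≤ |L G| := le_abs_self _
      _ ≤ M * ‖G‖ := hM G
      _ ≤ |M| * ‖G‖ := by gcongr; exact le_abs_self _
      _ ≤ _ := by gcongr
  have hle : ∀ (F : C(Y, ℝ≥0)) (G : C(Y, ℝ)), (∀ y, |G y| ≤ F y) → L G ≤ lamF L F :=
    fun F G hG => le_csSup (hbd F) ⟨G, hG, rfl⟩
  have hsup : ∀ (F : C(Y, ℝ≥0)) (B : ℝ), (∀ G : C(Y, ℝ), (∀ y, |G y| ≤ F y) → L G ≤ B) →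
      lamF L F ≤ B := by
    intro F B h
    refine csSup_le (hne F) ?_
    rintro _ ⟨G, hG, rfl⟩
    exact h G hG
  have hladd : ∀ F G, lamF L (F + G) = lamF L F + lamF L G := by
    intro F G
    apply le_antisymm
    · refine hsup _ _ fun H hH => ?_
      let H1 : C(Y, ℝ) := ⟨fun y => max (-(F y : ℝ)) (min (F y) (H y)), by fun_prop⟩
      have e : H = H1 + (H - H1) := by abel
      rw [e, map_add]
      refine add_le_add (hle _ _ fun y => ?_) (hle _ _ fun y => ?_)
      · have := (F y).coe_nonneg
        simp only [H1, ContinuousMap.coe_mk, abs_le]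
        constructor
        · exact le_max_left _ _
        · exact max_le (by linarith) (min_le_left _ _)
      · have h1 := (F y).coe_nonneg
        have h2 := (G y).coe_nonneg
        have h3 := abs_le.1 (hH y)
        simp only [ContinuousMap.add_apply, NNReal.coe_add] at h3
        simp only [H1, ContinuousMap.coe_mk, abs_le, ContinuousMap.sub_apply]
        rcases max_cases (-(F y : ℝ)) (min (F y) (H y)) with ⟨h, h'⟩ | ⟨h, h'⟩ <;>
        rcases min_cases (F y : ℝ) (H y) with ⟨h4, h5⟩ | ⟨h4, h5⟩ <;> rw [h] <;>
        constructor <;> linarith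
    · rw [← le_sub_iff_add_le]
      refine hsup _ _ fun H hH => ?_
      rw [le_sub_iff_add_le, add_comm, ← le_sub_iff_add_le]
      refine hsup _ _ fun K hK => ?_
      rw [le_sub_iff_add_le, add_comm, ← map_add]
      refine hle _ _ fun y => ?_
      simp only [ContinuousMap.add_apply, NNReal.coe_add]
      exact (abs_add_le _ _).trans (add_le_add (hH y) (hK y))
  have hls1 : ∀ (c : ℝ≥0) F, 0 < c → lamF L (c • F) ≤ c * lamF L F := by
    intro c F hc
    have hc' : (0:ℝ) < c := hc
    refine hsup _ _ fun H hH => ?_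
    have e : H = (c : ℝ) • ((c : ℝ)⁻¹ • H) := by rw [smul_smul, mul_inv_cancel₀ hc'.ne', one_smul]
    rw [e, map_smul, smul_eq_mul]
    refine mul_le_mul_of_nonneg_left (hle _ _ fun y => ?_) hc'.le
    have := hH y
    simp only [ContinuousMap.smul_apply, smul_eq_mul, NNReal.coe_mul] at this ⊢
    rw [abs_mul, abs_of_pos (inv_pos.2 hc'), inv_mul_le_iff₀ hc']
    exact this
  have hl0 : lamF L 0 = 0 := by
    have := hladd 0 0
    rw [add_zero] at this; linarith
  have hls : ∀ (c : ℝ≥0) F, lamF L (c • F) = c * lamF L F := by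
    intro c F
    rcases eq_or_ne c 0 with rfl | hc
    · simp [hl0]
    have hc : 0 < c := pos_iff_ne_zero.2 hc
    have hc' : (0:ℝ) < c := hc
    refine le_antisymm (hls1 c F hc) ?_
    have := hls1 c⁻¹ (c • F) (inv_pos.2 hc)
    rw [smul_smul, inv_mul_cancel₀ hc.ne', one_smul, NNReal.coe_inv, ← div_eq_inv_mul, le_div_iff₀ hc'] at this
    linarith
  let J : C(Y, ℝ≥0) → C(Y, ℝ) := fun F => ⟨fun y => F y, by fun_prop⟩
  have hJadd : ∀ F G, J (F + G) = J F + J G := fun F G => by ext y; simp [J]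
  have hJs : ∀ (c : ℝ≥0) F, J (c • F) = (c : ℝ) • J F := fun c F => by ext y; simp [J]
  have hJ1 : ∀ F, L (J F) ≤ lamF L F := fun F => hle _ _ fun y => by simp [J]
  have hJ2 : ∀ F, -L (J F) ≤ lamF L F := fun F => by
    rw [← map_neg]; exact hle _ _ fun y => by simp [J]
  obtain ⟨p, hp1, hp2, hp⟩ := aux_riesz_pos (fun F => (lamF L F + L (J F)) / 2)
    (fun F => by linarith [hJ2 F]) (fun F G => by simp only [hladd, hJadd, map_add]; ring)
    (fun c F => by simp only [hls, hJs, map_smul, smul_eq_mul]; ring)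
  obtain ⟨n, hn1, hn2, hn⟩ := aux_riesz_pos (fun F => (lamF L F - L (J F)) / 2)
    (fun F => by linarith [hJ1 F]) (fun F G => by simp only [hladd, hJadd, map_add]; ring)
    (fun c F => by simp only [hls, hJs, map_smul, smul_eq_mul]; ring)
  refine ⟨p, n, hp1, hn1, hp2, hn2, ?_, ?_⟩
  · have hint : ∀ (m : Measure Y) [IsFiniteMeasure m] (F : C(Y, ℝ)), Integrable F m :=
      fun m _ F => F.continuous.integrable_of_hasCompactSupport (HasCompactSupport.of_compactSpace F)
    have hpos : ∀ F : C(Y, ℝ≥0), L (J F) = ∫ y, (F y : ℝ) ∂p - ∫ y, (F y : ℝ) ∂n := by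
      intro F
      have e : ∀ m : Measure Y, ∫ y, (F y : ℝ) ∂m = (∫⁻ y, F y ∂m).toReal := by
        intro m
        rw [integral_eq_lintegral_of_nonneg_ae (Eventually.of_forall fun y => by simp)
          (by fun_prop)]
        simp
      rw [e, e, hp, hn, ENNReal.toReal_ofReal (by linarith [hJ2 F]),
        ENNReal.toReal_ofReal (by linarith [hJ1 F])]
      ring
    intro F
    let P : C(Y, ℝ≥0) := ⟨fun y => (F y).toNNReal, by fun_prop⟩
    let N : C(Y, ℝ≥0) := ⟨fun y => (-F y).toNNReal, by fun_prop⟩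
    have e : F = J P - J N := by
      ext y
      simp only [J, P, N, ContinuousMap.coe_mk, ContinuousMap.sub_apply, Real.coe_toNNReal']
      rcases le_total 0 (F y) with h | h
      · rw [max_eq_left h, max_eq_right (by linarith)]; ring
      · rw [max_eq_right h, max_eq_left (by linarith)]; ring
    have e2 : ∀ (m : Measure Y) [IsFiniteMeasure m],
        ∫ y, F y ∂m = ∫ y, (P y : ℝ) ∂m - ∫ y, (N y : ℝ) ∂m := by
      intro m _
      refine Eq.trans ?_ (integral_sub (hint m (J P)) (hint m (J N)))
      congr 1; ext y
      exact congrArg (fun H : C(Y, ℝ) => H y) e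
    rw [e2, e2]
    conv_lhs => rw [e]
    rw [map_sub, hpos, hpos]; ring
  · intro F B hB
    rw [lintegral_add_measure, hp, hn, ← ENNReal.ofReal_add (by linarith [hJ2 F]) (by linarith [hJ1 F])]
    refine ENNReal.ofReal_le_ofReal ?_
    linarith [hsup F B hB]

theorem aux_jordan {X : Type*} [MeasurableSpace X] (p n : Measure X) [IsFiniteMeasure p]
    [IsFiniteMeasure n] (s : SignedMeasure X) (hs : s = p.toSignedMeasure - n.toSignedMeasure) :
    s.toJordanDecomposition.posPart ≤ p ∧ s.toJordanDecomposition.negPart ≤ n ∧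
      s.toJordanDecomposition.posPart + n = p + s.toJordanDecomposition.negPart := by
  obtain ⟨k, hi, hi1, hi2, hpos, hneg⟩ := s.toJordanDecomposition_spec
  have key : s.toJordanDecomposition.posPart + n = p + s.toJordanDecomposition.negPart := by
    rw [← Measure.toSignedMeasure_eq_toSignedMeasure_iff, Measure.toSignedMeasure_add,
      Measure.toSignedMeasure_add]
    have := s.toSignedMeasure_toJordanDecomposition
    rw [JordanDecomposition.toSignedMeasure, hs] at this
    rw [hs]
    rw [sub_eq_sub_iff_add_eq_add] at this
    rw [this]
  have hz1 : s.toJordanDecomposition.posPart kᶜ = 0 := by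
    rw [hpos, SignedMeasure.toMeasureOfZeroLE_apply _ hi1 _ hi.compl]
    simp only [inter_compl_self, VectorMeasure.empty]; rfl
  have hz2 : s.toJordanDecomposition.negPart kᶜᶜ = 0 := by
    rw [compl_compl, hneg, SignedMeasure.toMeasureOfLEZero_apply _ hi2 _ hi]
    simp only [compl_inter_self, VectorMeasure.empty, neg_zero]; rfl
  generalize kᶜ = i at hz1 hz2
  refine ⟨?_, ?_, key⟩
  · refine Measure.le_iff.2 fun A hA => ?_
    have h1 := congrArg (fun m : Measure X => m (A \ i)) key
    simp only [Measure.add_apply] at h1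
    have h2 : s.toJordanDecomposition.negPart (A \ i) = 0 := measure_mono_null (fun x hx => hx.2) hz2
    rw [h2, add_zero] at h1
    calc s.toJordanDecomposition.posPart A ≤ s.toJordanDecomposition.posPart (A \ i) + s.toJordanDecomposition.posPart i :=
          (measure_mono (fun x hx => by by_cases h : x ∈ i <;> simp [h, hx])).trans (measure_union_le _ _)
      _ = s.toJordanDecomposition.posPart (A \ i) := by rw [hz1, add_zero]
      _ ≤ p (A \ i) := by rw [← h1]; exact le_self_add
      _ ≤ p A := measure_mono sdiff_subset
  · refine Measure.le_iff.2 fun A hA => ?_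
    have h1 := congrArg (fun m : Measure X => m (A ∩ i)) key
    simp only [Measure.add_apply] at h1
    have h2 : s.toJordanDecomposition.posPart (A ∩ i) = 0 := measure_mono_null (fun x hx => hx.2) hz1
    rw [h2, zero_add] at h1
    calc s.toJordanDecomposition.negPart A ≤ s.toJordanDecomposition.negPart (A ∩ i) + s.toJordanDecomposition.negPart iᶜ :=
          (measure_mono (fun x hx => by by_cases h : x ∈ i <;> simp [h, hx])).trans (measure_union_le _ _)
      _ = s.toJordanDecomposition.negPart (A ∩ i) := by rw [hz2, add_zero]
      _ ≤ n (A ∩ i) := by rw [h1]; exact le_add_self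
      _ ≤ n A := measure_mono inter_subset_left

theorem aux_regular {X : Type*} [TopologicalSpace X] [T2Space X] [MeasurableSpace X] [BorelSpace X]
    (m ν : Measure X) [IsFiniteMeasure ν] [ν.InnerRegular] (h : m ≤ ν) : m.Regular := by
  have : IsFiniteMeasure m := isFiniteMeasure_of_le ν h
  have : m.InnerRegular := by
    refine ⟨fun A hA r hr => ?_⟩
    obtain ⟨ε, hε, hrε⟩ : ∃ ε : ℝ≥0∞, 0 < ε ∧ r + ε < m A := by
      obtain ⟨c, hc1, hc2⟩ := exists_between hr
      exact ⟨c - r, tsub_pos_of_lt hc1, by rwa [add_tsub_cancel_of_le hc1.le]⟩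
    obtain ⟨K, hKA, hK, hd⟩ := MeasurableSet.exists_isCompact_sdiff_lt hA (measure_ne_top ν A) hε.ne'
    refine ⟨K, hKA, hK, ?_⟩
    by_contra hcon
    rw [not_lt] at hcon
    have : m A ≤ r + ε := calc
      m A ≤ m K + m (A \ K) := (measure_mono (by simp)).trans (measure_union_le _ _)
      _ ≤ r + ε := add_le_add hcon ((h _).trans hd.le)
    exact absurd hrε (not_lt.2 this)
  infer_instance

theorem aux_comap {X Y : Type*} [TopologicalSpace X] [T2Space X] [MeasurableSpace X] [BorelSpace X]
    [TopologicalSpace Y] [T2Space Y] [MeasurableSpace Y] [BorelSpace Y]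
    (i : X → Y) (hi : IsEmbedding i) (hr : MeasurableSet (range i)) (p : Measure Y)
    [IsFiniteMeasure p] [p.InnerRegular] (h0 : p (range i)ᶜ = 0) :
    ∃ ν : Measure X, IsFiniteMeasure ν ∧ ν.InnerRegular ∧ ν.map i = p := by
  have hm : MeasurableEmbedding i := hi.measurableEmbedding hr
  have hmap : (p.comap i).map i = p := by
    rw [hm.map_comap]
    exact Measure.restrict_eq_self_of_ae_mem h0
  refine ⟨p.comap i, ⟨?_⟩, ⟨fun A hA r hrA => ?_⟩, hmap⟩
  · rw [hm.comap_apply]; exact measure_lt_top _ _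
  · rw [hm.comap_apply] at hrA
    obtain ⟨K, hKA, hK, hlt⟩ := MeasurableSet.exists_lt_isCompact (hm.measurableSet_image.2 hA) hrA
    have hKr : K ⊆ range i := hKA.trans (image_subset_range _ _)
    refine ⟨i ⁻¹' K, ?_, hi.isInducing.isCompact_preimage' hK hKr, ?_⟩
    · intro x hx
      obtain ⟨z, hz, hzx⟩ := hKA hx
      rwa [← hi.injective hzx]
    · rwa [hm.comap_apply, image_preimage_eq_of_subset hKr]

theorem aux_cb {X : Type*} [TopologicalSpace X] (ρ : X → ℝ) (c : ℝ) (hc : 0 < c)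
    (hcρ : ∀ x, c ≤ ρ x) (g : X → ℝ) (hg : Continuous g) (C : ℝ) (hC : ∀ x, |g x| ≤ C) :
    MemCb ρ g := by
  refine ⟨⟨|C| / c, fun x => ?_⟩, fun ε hε => ⟨g, hg, ⟨C, hC⟩, fun x => ?_⟩⟩
  · calc |g x| ≤ |C| := (hC x).trans (le_abs_self _)
      _ = |C| / c * c := by field_simp
      _ ≤ |C| / c * ρ x := by gcongr; exact hcρ x
  · simp only [sub_self, abs_zero]
    exact mul_nonneg hε.le (hc.le.trans (hcρ x))

theorem aux_smul {X : Type*} [TopologicalSpace X] (ρ : X → ℝ)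
    (hρ : ∀ x, 0 < ρ x) (f : X → ℝ) (hf : MemCb ρ f) (c : ℝ) :
    MemCb ρ (c • f) := by
  obtain ⟨⟨K, hK⟩, hf⟩ := hf
  refine ⟨⟨|c| * K, fun x => ?_⟩, fun ε hε => ?_⟩
  · simp only [Pi.smul_apply, smul_eq_mul, abs_mul, mul_assoc]
    exact mul_le_mul_of_nonneg_left (hK x) (abs_nonneg _)
  · have h1 : 0 < |c| + 1 := by positivity
    obtain ⟨g, hg, ⟨C, hC⟩, hfg⟩ := hf (ε / (|c| + 1)) (by positivity)
    refine ⟨c • g, hg.const_smul c, ⟨|c| * C, fun x => ?_⟩, fun x => ?_⟩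
    · simp only [Pi.smul_apply, smul_eq_mul, abs_mul]
      exact mul_le_mul_of_nonneg_left (hC x) (abs_nonneg _)
    · simp only [Pi.smul_apply, smul_eq_mul, ← mul_sub, abs_mul]
      have := hρ x
      calc |c| * |f x - g x| ≤ (|c| + 1) * (ε / (|c| + 1) * ρ x) := by
            gcongr
            · linarith
            · exact hfg x
        _ = ε * ρ x := by field_simp

theorem aux_bound {X : Type*} [TopologicalSpace X] (ρ : X → ℝ) (hρ : ∀ x, 0 < ρ x)
    (ℓ : (X → ℝ) → ℝ)
    (hsmul : ∀ (c : ℝ) (f), MemCb ρ f → ℓ (c • f) = c * ℓ f)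
    (hbdd : ∃ C : ℝ, ∀ f, MemCb ρ f → |ℓ f| ≤ C * rnorm ρ f)
    (f : X → ℝ) (hf : MemCb ρ f) (c : ℝ) (hc : 0 ≤ c) (h : ∀ x, |f x| ≤ c * ρ x) :
    |ℓ f| ≤ c * opNormF ρ ℓ := by
  rcases hc.eq_or_lt with rfl | hc
  · have : f = (0 : ℝ) • f := by
      ext x; have := h x; rw [zero_mul] at this
      simpa using this
    rw [this, hsmul 0 f hf]; simp
  have hbdA : BddAbove {r : ℝ | ∃ f, MemCb ρ f ∧ rnorm ρ f ≤ 1 ∧ r = |ℓ f|} := by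
    obtain ⟨C, hC⟩ := hbdd
    refine ⟨|C|, ?_⟩
    rintro _ ⟨f, hf, hf1, rfl⟩
    have h0 : 0 ≤ rnorm ρ f := Real.sSup_nonneg (by
      rintro _ ⟨x, rfl⟩
      have := hρ x
      positivity)
    calc |ℓ f| ≤ C * rnorm ρ f := hC f hf
      _ ≤ |C| * rnorm ρ f := by gcongr; exact le_abs_self _
      _ ≤ |C| * 1 := by gcongr
      _ = |C| := mul_one _
  have hmem : |ℓ (c⁻¹ • f)| ≤ opNormF ρ ℓ := by
    refine le_csSup hbdA ⟨c⁻¹ • f, aux_smul ρ hρ f hf _, ?_, rfl⟩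
    refine Real.sSup_le ?_ zero_le_one
    rintro _ ⟨x, rfl⟩
    have := hρ x
    simp only [Pi.smul_apply, smul_eq_mul, abs_mul, abs_of_pos (inv_pos.2 hc)]
    rw [inv_mul_le_iff₀ this, inv_mul_le_iff₀ hc, mul_one]
    exact h x
  rw [hsmul _ f hf, abs_mul, abs_of_pos (inv_pos.2 hc), inv_mul_le_iff₀ hc] at hmem
  exact hmem

theorem riesz_representation_Brho
    {X : Type*} [TopologicalSpace X] [T2Space X] [CompletelyRegularSpace X]
    [MeasurableSpace X] [BorelSpace X]
    (ρ : X → ℝ) (hρ : Admissible ρ)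
    (ℓ : (X → ℝ) → ℝ)
    (hadd : ∀ f g, MemCb ρ f → MemCb ρ g → ℓ (f + g) = ℓ f + ℓ g)
    (hsmul : ∀ (c : ℝ) (f), MemCb ρ f → ℓ (c • f) = c * ℓ f)
    (hbdd : ∃ C : ℝ, ∀ f, MemCb ρ f → |ℓ f| ≤ C * rnorm ρ f) :
    ∃ μ : MeasureTheory.SignedMeasure X,
      (MeasureTheory.SignedMeasure.totalVariation μ).Regular ∧
      (∀ f, MemCb ρ f →
        ℓ f = (∫ x, f x ∂μ.toJordanDecomposition.posPart)
              - ∫ x, f x ∂μ.toJordanDecomposition.negPart) ∧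
      ∫ x, ρ x ∂(MeasureTheory.SignedMeasure.totalVariation μ) = opNormF ρ ℓ := by
  obtain ⟨hpos, hcpt⟩ := hρ
  have hbound := aux_bound ρ hpos ℓ hsmul hbdd
  set N := opNormF ρ ℓ with hN
  have hN0 : 0 ≤ N := Real.sSup_nonneg (by rintro _ ⟨f, -, -, rfl⟩; positivity)
  -- closed sublevels
  have hcl : ∀ R : ℝ, IsClosed {x | ρ x ≤ R} := by
    intro R
    rcases le_or_gt R 0 with h | h
    · convert isClosed_empty
      ext x; simpa using h.trans_lt (hpos x)
    · exact (hcpt R h).isClosed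
  have hlsc : LowerSemicontinuous ρ := lowerSemicontinuous_iff_isClosed_preimage.2 hcl
  have hmeas : Measurable ρ := hlsc.measurable
  -- lower bound
  obtain ⟨c, hc, hcρ⟩ : ∃ c : ℝ, 0 < c ∧ ∀ x, c ≤ ρ x := by
    rcases isEmpty_or_nonempty X with h | ⟨⟨x0⟩⟩
    · exact ⟨1, one_pos, fun x => h.elim x⟩
    · obtain ⟨a, ha, hmin⟩ := LowerSemicontinuousOn.exists_isMinOn (s := {x | ρ x ≤ ρ x0})
        ⟨x0, le_refl (ρ x0)⟩ (hcpt _ (hpos x0)) (hlsc.lowerSemicontinuousOn _)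
      refine ⟨ρ a, hpos a, fun x => ?_⟩
      rcases le_total (ρ x) (ρ x0) with h | h
      · exact hmin h
      · exact le_trans ha h
  have hcb := aux_cb ρ c hc hcρ
  have : T35Space X := {}
  let _ : MeasurableSpace (StoneCech X) := borel _
  have _ : BorelSpace (StoneCech X) := ⟨rfl⟩
  let i : X → StoneCech X := stoneCechUnit
  have hi : IsEmbedding i := isEmbedding_stoneCechUnit
  have hFcb : ∀ F : C(StoneCech X, ℝ), MemCb ρ (F ∘ i) := fun F =>
    hcb _ (F.continuous.comp hi.continuous) ‖F‖ fun x => F.norm_coe_le_norm (i x)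
  let L : C(StoneCech X, ℝ) →ₗ[ℝ] ℝ :=
    { toFun := fun F => ℓ (F ∘ i)
      map_add' := fun F G => hadd _ _ (hFcb F) (hFcb G)
      map_smul' := fun a F => hsmul a _ (hFcb F) }
  obtain ⟨p, n, hp, hn, hpr, hnr, hL, hB⟩ := aux_riesz L (N / c) (fun G => by
    have := hbound _ (hFcb G) (‖G‖ / c) (by positivity) (fun x => by
      calc |G (i x)| ≤ ‖G‖ := G.norm_coe_le_norm (i x)
        _ = ‖G‖ / c * c := by field_simp
        _ ≤ _ := by gcongr; exact hcρ x)
    refine this.trans (le_of_eq ?_)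
    ring)
  -- extended weight
  classical
  let r : StoneCech X → ℝ≥0∞ := Function.extend i (fun x => ENNReal.ofReal (ρ x)) (fun _ => ∞)
  have hri : ∀ x, r (i x) = ENNReal.ofReal (ρ x) := fun x => hi.injective.extend_apply _ _ x
  have hrn : ∀ y, y ∉ range i → r y = ∞ := fun y hy => Function.extend_apply' _ _ _ hy
  have hrs : ∀ a : ℝ≥0, {y | r y ≤ a} = i '' {x | ρ x ≤ a} := by
    intro a
    ext y
    constructor
    · intro hy
      by_cases h : y ∈ range i
      · obtain ⟨x, rfl⟩ := h
        refine ⟨x, ?_, rfl⟩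
        have : r (i x) ≤ a := hy
        rw [hri] at this
        simpa [ENNReal.ofReal, Real.toNNReal_le_iff_le_coe] using this
      · have : r y ≤ a := hy
        rw [hrn y h] at this
        simp at this
    · rintro ⟨x, hx, rfl⟩
      show r (i x) ≤ a
      rw [hri]
      simpa [ENNReal.ofReal, Real.toNNReal_le_iff_le_coe] using hx
  have hcptR : ∀ R : ℝ, IsCompact {x | ρ x ≤ R} := fun R => by
    refine (hcpt (max R 1) (by positivity)).of_isClosed_subset (hcl R) fun x hx => ?_
    exact le_trans (show ρ x ≤ R from hx) (le_max_left _ _)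
  have hrc : ∀ a : ℝ≥0, IsClosed {y | r y ≤ a} := fun a => by
    rw [hrs]; exact ((hcptR a).image hi.continuous).isClosed
  have hint : ∫⁻ y, r y ∂(p + n) ≤ ENNReal.ofReal N := by
    refine aux_lsc _ r hrc _ fun F hF => hB F N fun G hG => ?_
    have := hbound _ (hFcb G) 1 zero_le_one (fun x => by
      refine (hG (i x)).trans ?_
      have := hF (i x)
      rw [hri] at this
      rw [one_mul]
      rwa [ENNReal.ofReal, ENNReal.coe_le_coe, ← NNReal.coe_le_coe, Real.coe_toNNReal _ (hpos x).le] at this)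
    rw [one_mul] at this
    exact (le_abs_self _).trans this
  have hrange : range i = ⋃ k : ℕ, i '' {x | ρ x ≤ k} := by
    rw [← image_univ, ← image_iUnion]
    congr 1
    symm
    rw [eq_univ_iff_forall]
    intro x
    obtain ⟨k, hk⟩ := exists_nat_ge (ρ x)
    exact mem_iUnion.2 ⟨k, hk⟩
  have hrmeas : MeasurableSet (range i) := by
    rw [hrange]
    exact MeasurableSet.iUnion fun k => ((hcptR k).image hi.continuous).isClosed.measurableSet
  have hrM : Measurable r := by
    refine measurable_of_Iic fun a => ?_
    rcases eq_or_ne a ∞ with rfl | ha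
    · simp
    · lift a to ℝ≥0 using ha
      exact (hrc a).measurableSet
  have hnull : (p + n) (range i)ᶜ = 0 := by
    have h1 := ae_lt_top hrM (ne_top_of_le_ne_top ENNReal.ofReal_ne_top hint)
    refine measure_mono_null (fun y hy => ?_) h1
    simp [hrn y hy]
  have hnull' : p (range i)ᶜ = 0 ∧ n (range i)ᶜ = 0 := by simpa using hnull
  obtain ⟨p', hpf, hpi, hp'⟩ := aux_comap i hi hrmeas p hnull'.1
  obtain ⟨n', hnf, hni, hn'⟩ := aux_comap i hi hrmeas n hnull'.2
  have hme : MeasurableEmbedding i := hi.measurableEmbedding hrmeas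
  have hρint : ∫⁻ x, ENNReal.ofReal (ρ x) ∂(p' + n') ≤ ENNReal.ofReal N := by
    rw [← hp', ← hn', ← Measure.map_add _ _ hme.measurable, hme.lintegral_map] at hint
    simpa only [hri] using hint
  set s : SignedMeasure X := p'.toSignedMeasure - n'.toSignedMeasure with hs
  obtain ⟨hle1, hle2, hkey⟩ := aux_jordan p' n' s hs
  set P := s.toJordanDecomposition.posPart with hP
  set Q := s.toJordanDecomposition.negPart with hQ
  have hPQ : P + Q ≤ p' + n' := add_le_add hle1 hle2
  have hρI : Integrable ρ (p' + n') := by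
    refine ⟨hmeas.aestronglyMeasurable, ?_⟩
    rw [hasFiniteIntegral_iff_ofReal (Eventually.of_forall fun x => (hpos x).le)]
    exact hρint.trans_lt ENNReal.ofReal_lt_top
  have hρN : ∫ x, ρ x ∂(p' + n') ≤ N := by
    rw [integral_eq_lintegral_of_nonneg_ae (Eventually.of_forall fun x => (hpos x).le) hmeas.aestronglyMeasurable]
    exact ENNReal.toReal_le_of_le_ofReal hN0 hρint
  have hρp : Integrable ρ p' := hρI.mono_measure (Measure.le_add_right le_rfl)
  have hρn : Integrable ρ n' := hρI.mono_measure (Measure.le_add_left le_rfl)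
  have hρadd : ∫ x, ρ x ∂p' + ∫ x, ρ x ∂n' ≤ N := by rwa [← integral_add_measure hρp hρn]
  have hfm : ∀ f, MemCb ρ f → Measurable f := by
    rintro f ⟨-, hf⟩
    choose! g hg _ hfg using hf
    have hu : ∀ k : ℕ, (0:ℝ) < 1 / ((k:ℝ) + 1) := fun k => by positivity
    refine measurable_of_tendsto_metrizable (f := fun k : ℕ => g (1 / ((k:ℝ) + 1)))
      (fun k => (hg _ (hu k)).measurable) ?_
    rw [tendsto_pi_nhds]
    intro x
    rw [tendsto_iff_dist_tendsto_zero]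
    have ht := (tendsto_one_div_add_atTop_nhds_zero_nat (𝕜 := ℝ)).mul_const (ρ x)
    rw [zero_mul] at ht
    refine squeeze_zero (fun _ => dist_nonneg) (fun k => ?_) ht
    rw [Real.dist_eq, abs_sub_comm]
    exact hfg _ (hu k) x
  have hfI : ∀ (m : Measure X), Integrable ρ m → ∀ f, MemCb ρ f → Integrable f m := by
    intro m hm f hf
    obtain ⟨K, hK⟩ := hf.1
    exact (hm.const_mul K).mono' (hfm f hf).aestronglyMeasurable (Eventually.of_forall hK)
  have hrepg : ∀ g : X → ℝ, Continuous g → (∃ C, ∀ x, |g x| ≤ C) →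
      ℓ g = ∫ x, g x ∂p' - ∫ x, g x ∂n' := by
    rintro g hg ⟨C, hC⟩
    have hg' : Continuous (fun x => (⟨g x, abs_le.1 (hC x)⟩ : Icc (-C) C)) := by fun_prop
    let G : C(StoneCech X, ℝ) := ⟨fun y => ((stoneCechExtend hg' y : Icc (-C) C) : ℝ),
      continuous_subtype_val.comp (continuous_stoneCechExtend hg')⟩
    have hG : ∀ x, G (i x) = g x := fun x => by
      simp only [G, ContinuousMap.coe_mk, i, stoneCechExtend_stoneCechUnit]
    have e : (G ∘ i : X → ℝ) = g := funext hG
    have := hL G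
    rw [← hp', ← hn', hme.integral_map, hme.integral_map] at this
    simp only [hG] at this
    rw [← this]
    show ℓ g = ℓ (G ∘ i)
    rw [e]
  have hrep : ∀ f, MemCb ρ f → ℓ f = ∫ x, f x ∂p' - ∫ x, f x ∂n' := by
    intro f hf
    have key : ∀ ε : ℝ, 0 < ε → |ℓ f - (∫ x, f x ∂p' - ∫ x, f x ∂n')| ≤ ε * (2 * N) := by
      intro ε hε
      obtain ⟨g, hg, ⟨C, hC⟩, hfg⟩ := hf.2 ε hε
      have hgm := hcb g hg C hC
      have hgm' := aux_smul ρ hpos g hgm (-1)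
      have hdm : MemCb ρ (f + (-1 : ℝ) • g) := by
        refine ⟨⟨ε, fun x => by simpa [sub_eq_add_neg] using hfg x⟩, fun δ hδ => ?_⟩
        obtain ⟨g', hg', ⟨C', hC'⟩, hfg'⟩ := hf.2 δ hδ
        refine ⟨g' + (-1 : ℝ) • g, by fun_prop, ⟨C' + C, fun x => ?_⟩, fun x => ?_⟩
        · have h1 := abs_le.1 (hC x)
          have h2 := abs_le.1 (hC' x)
          simp only [Pi.add_apply, Pi.smul_apply, smul_eq_mul, abs_le]
          constructor <;> linarith
        · simpa using hfg' x
      have h1 := hbound _ hdm ε hε.le (fun x => by simpa [sub_eq_add_neg] using hfg x)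
      rw [hadd _ _ hf hgm', hsmul _ _ hgm, hrepg g hg ⟨C, hC⟩] at h1
      have h2 : ∀ m : Measure X, Integrable ρ m →
          |∫ x, f x ∂m - ∫ x, g x ∂m| ≤ ε * ∫ x, ρ x ∂m := by
        intro m hm
        rw [← integral_sub (hfI m hm f hf) (hfI m hm g hgm), ← integral_const_mul]
        exact norm_integral_le_of_norm_le (f := fun x => f x - g x) (hm.const_mul ε) (Eventually.of_forall hfg)
      have h3 := abs_le.1 (h2 p' hρp)
      have h4 := abs_le.1 (h2 n' hρn)
      have h5 := mul_le_mul_of_nonneg_left hρadd hε.le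
      rw [mul_add] at h5
      have h1 := abs_le.1 h1
      rw [abs_le]
      constructor <;> linarith
    by_contra hne
    have h0 : 0 < |ℓ f - (∫ x, f x ∂p' - ∫ x, f x ∂n')| := abs_pos.2 (sub_ne_zero.2 hne)
    set d := |ℓ f - (∫ x, f x ∂p' - ∫ x, f x ∂n')|
    have h6 := key (d / (2 * N + 1)) (by positivity)
    rw [div_mul_eq_mul_div, le_div_iff₀ (by positivity)] at h6
    linarith
  have hρPQ : Integrable ρ (P + Q) := hρI.mono_measure hPQ
  have hρP : Integrable ρ P := hρp.mono_measure hle1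
  have hρQ : Integrable ρ Q := hρn.mono_measure hle2
  have hrep' : ∀ f, MemCb ρ f → ℓ f = ∫ x, f x ∂P - ∫ x, f x ∂Q := by
    intro f hf
    have h1 := congrArg (fun m : Measure X => ∫ x, f x ∂m) hkey
    rw [integral_add_measure (hfI _ hρP f hf) (hfI _ hρn f hf),
      integral_add_measure (hfI _ hρp f hf) (hfI _ hρQ f hf)] at h1
    rw [hrep f hf]; linarith
  refine ⟨s, ?_, hrep', ?_⟩
  · exact aux_regular (P + Q) (p' + n') hPQ
  · show ∫ x, ρ x ∂(P + Q) = N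
    apply le_antisymm
    · exact (integral_mono_measure hPQ (Eventually.of_forall fun x => (hpos x).le) hρI).trans hρN
    · refine Real.sSup_le ?_ (integral_nonneg fun x => (hpos x).le)
      rintro _ ⟨f, hf, hf1, rfl⟩
      have hfρ : ∀ x, |f x| ≤ ρ x := by
        intro x
        obtain ⟨K, hK⟩ := hf.1
        have hb : BddAbove (range fun x => (ρ x)⁻¹ * |f x|) := by
          refine ⟨K, ?_⟩
          rintro _ ⟨z, rfl⟩
          show (ρ z)⁻¹ * |f z| ≤ K
          rw [inv_mul_le_iff₀ (hpos z), mul_comm]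
          exact hK z
        have := (le_csSup hb ⟨x, rfl⟩).trans hf1
        simpa [inv_mul_le_iff₀ (hpos x)] using this
      rw [hrep' f hf, integral_add_measure hρP hρQ]
      refine (abs_sub _ _).trans (add_le_add ?_ ?_)
      · exact norm_integral_le_of_norm_le (f := f) hρP (Eventually.of_forall hfρ)
      · exact norm_integral_le_of_norm_le (f := f) hρQ (Eventually.of_forall hfρ)
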